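/- arXiv:0909.2230 — 2 statements merged into one kernel-verified Lean document; each statement's English description precedes it below -/
import Mathlib

section
/- Let n ≥ 2 and let f be a fixed-point-free involution of ZMod (2n) with four distinct points p, p+1, q, q+1 satisfying f p = q + 1 and f (p+1) = q, and set c₁ = {p, q+1}, c₂ = {p+1, q} (the two chords removed by a second Reidemeister move). Then for every chord D of f other than c₁ and c₂, the number of chords of f distinct from c₁ and c₂ that are linked with D has the same parity as the number of chords of f that are linked with D. In other words, deleting the pair of chords c₁, c₂ does not change the Gaussian parity of any remaining chord. (This is the paper's requirement that a second Reidemeister move preserves the parity of the remaining crossings.) -/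
/-- `x` lies strictly between `a` and `b` in the cyclic order on `ZMod m`:
writing `b = a + j` with `j = (b - a).val`, `x = a + k` for some `1 ≤ k ≤ j - 1`. -/
def inOpenArc {m : ℕ} (a b x : ZMod m) : Prop :=
  ∃ k : ℕ, 1 ≤ k ∧ k < (b - a).val ∧ x = a + (k : ZMod m)

/-- The pairs `{a, b}` and `{c, d}` are linked: exactly one of `c`, `d`
lies in the open arc from `a` to `b`. -/
def linked {m : ℕ} (a b c d : ZMod m) : Prop :=
  Xor' (inOpenArc a b c) (inOpenArc a b d)

/-- Linking of unordered pairs (given as two-element finsets). -/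
def linkedPair {m : ℕ} (P Q : Finset (ZMod m)) : Prop :=
  ∃ a b c d : ZMod m, P = {a, b} ∧ Q = {c, d} ∧ linked a b c d

/-- The chords of a chord diagram given by an involution `f` of `ZMod (2*n)`. -/
def chords {n : ℕ} (f : ZMod (2 * n) → ZMod (2 * n)) : Set (Finset (ZMod (2 * n))) :=
  {P | ∃ a, P = {a, f a}}

lemma aux_sub {m : ℕ} [NeZero m] (u v : ZMod m) :
    (u - v).val = if v.val ≤ u.val then u.val - v.val else m + u.val - v.val := by
  have hu := ZMod.val_lt u
  have hv := ZMod.val_lt v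
  split_ifs with h
  · exact ZMod.val_sub h
  · have h1 : ((m + u.val - v.val : ℕ) : ZMod m) = u - v := by
      rw [Nat.cast_sub (by omega)]; simp
    rw [← h1, ZMod.val_natCast, Nat.mod_eq_of_lt (by omega)]

lemma aux_succ {m : ℕ} [NeZero m] (hm : 1 < m) (u : ZMod m) :
    (u + 1).val = if u.val + 1 = m then 0 else u.val + 1 := by
  have hu := ZMod.val_lt u
  haveI : Fact (1 < m) := ⟨hm⟩
  rw [ZMod.val_add, ZMod.val_one]
  split_ifs with h
  · rw [h, Nat.mod_self]
  · exact Nat.mod_eq_of_lt (by omega)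

lemma aux_arc {m : ℕ} [NeZero m] (a b x : ZMod m) :
    inOpenArc a b x ↔ 0 < (x - a).val ∧ (x - a).val < (b - a).val := by
  constructor
  · rintro ⟨k, h1, h2, rfl⟩
    have := ZMod.val_lt (b - a)
    rw [add_sub_cancel_left, ZMod.val_natCast, Nat.mod_eq_of_lt (by omega)]
    omega
  · rintro ⟨h1, h2⟩
    exact ⟨(x - a).val, h1, h2, by simp⟩

lemma aux_ne {m : ℕ} [NeZero m] {a b : ZMod m} (h : a ≠ b) : a.val ≠ b.val :=
  fun h' => h (ZMod.val_injective m h')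

lemma aux_swap {m : ℕ} [NeZero m] {a b x : ZMod m} (hab : a ≠ b) (hxa : x ≠ a) (hxb : x ≠ b) :
    inOpenArc a b x ↔ ¬ inOpenArc b a x := by
  have h1 := aux_ne hab
  have h2 := aux_ne hxa
  have h3 := aux_ne hxb
  have := ZMod.val_lt a
  have := ZMod.val_lt b
  have := ZMod.val_lt x
  simp only [aux_arc, aux_sub]
  split_ifs <;> omega

lemma aux_shift {m : ℕ} [NeZero m] (hm : 1 < m) {p q x : ZMod m}
    (h1 : p ≠ q) (h2 : p ≠ q + 1) (h0 : p + 1 ≠ q)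
    (h3 : x ≠ p) (h4 : x ≠ p + 1) (h5 : x ≠ q) (h6 : x ≠ q + 1) :
    inOpenArc p (q + 1) x ↔ inOpenArc (p + 1) q x := by
  have h1 := aux_ne h1
  have h2 := aux_ne h2
  have h0 := aux_ne h0
  have h3 := aux_ne h3
  have h4 := aux_ne h4
  have h5 := aux_ne h5
  have h6 := aux_ne h6
  have := ZMod.val_lt p
  have := ZMod.val_lt q
  have := ZMod.val_lt x
  simp only [aux_arc, aux_sub]
  simp only [aux_succ hm] at *
  split_ifs at * <;> omega

lemma aux_pair {α : Type*} [DecidableEq α] {a b c d : α} (h : ({a, b} : Finset α) = {c, d}) :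
    (a = c ∧ b = d) ∨ (a = d ∧ b = c) := by
  have := congrArg (fun s : Finset α => (s : Set α)) h
  simp only [Finset.coe_pair] at this
  exact Set.pair_eq_pair_iff.mp this

lemma aux_linked {m : ℕ} [NeZero m] {a b c d : ZMod m} (hab : a ≠ b)
    (hca : c ≠ a) (hcb : c ≠ b) (hda : d ≠ a) (hdb : d ≠ b) :
    linkedPair {a, b} {c, d} ↔ linked a b c d := by
  constructor
  · rintro ⟨a', b', c', d', h1, h2, h⟩
    have e1 := aux_swap hab hca hcb
    have e2 := aux_swap hab hda hdb
    simp only [linked, Xor', xor_def] at *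
    rcases aux_pair h1 with ⟨rfl, rfl⟩ | ⟨rfl, rfl⟩ <;>
    rcases aux_pair h2 with ⟨rfl, rfl⟩ | ⟨rfl, rfl⟩ <;> grind
  · intro h
    exact ⟨a, b, c, d, rfl, rfl, h⟩

/-- Deleting the pair of chords removed by a second Reidemeister move does not
change the Gaussian parity of any remaining chord. -/
theorem second_move_preserves_parity (n : ℕ) (hn : 2 ≤ n)
    (f : ZMod (2 * n) → ZMod (2 * n)) (hinv : Function.Involutive f)
    (hfpf : ∀ x, f x ≠ x) (p q : ZMod (2 * n))
    (hdist : ({p, p + 1, q, q + 1} : Finset (ZMod (2 * n))).card = 4)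
    (hp : f p = q + 1) (hp1 : f (p + 1) = q) :
    ∀ D ∈ chords f, D ≠ ({p, q + 1} : Finset (ZMod (2 * n))) →
      D ≠ ({p + 1, q} : Finset (ZMod (2 * n))) →
      (Set.ncard {E ∈ chords f | E ≠ ({p, q + 1} : Finset (ZMod (2 * n))) ∧
          E ≠ ({p + 1, q} : Finset (ZMod (2 * n))) ∧ linkedPair E D}) % 2 =
        (Set.ncard {E ∈ chords f | linkedPair E D}) % 2 := by
  classical
  haveI : NeZero (2 * n) := ⟨by omega⟩
  have hm : 1 < 2 * n := by omega
  have n1 : p ≠ q := by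
    rintro rfl
    have := Finset.card_le_two (a := p) (b := p + 1)
    simp at hdist
    omega
  have n2 : p ≠ q + 1 := fun h => hfpf p (hp.trans h.symm)
  have n0 : p + 1 ≠ q := fun h => hfpf (p + 1) (hp1.trans h.symm)
  have hq1 : f (q + 1) = p := by rw [← hp, hinv]
  have hq : f q = p + 1 := by rw [← hp1, hinv]
  have n3 : p ≠ p + 1 := by
    intro h
    have h10 : (1 : ZMod (2 * n)) = 0 := by simpa using h.symm
    haveI : Fact (1 < 2 * n) := ⟨hm⟩
    exact one_ne_zero h10
  rintro D ⟨c, rfl⟩ hD1 hD2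
  have c1 : c ≠ p := by rintro rfl; exact hD1 (by rw [hp])
  have c2 : c ≠ q + 1 := by rintro rfl; exact hD1 (by rw [hq1, Finset.pair_comm])
  have c3 : c ≠ p + 1 := by rintro rfl; exact hD2 (by rw [hp1])
  have c4 : c ≠ q := by rintro rfl; exact hD2 (by rw [hq, Finset.pair_comm])
  have d1 : f c ≠ p := fun h => c2 (by rw [← hinv c, h, hp])
  have d2 : f c ≠ q + 1 := fun h => c1 (by rw [← hinv c, h, hq1])
  have d3 : f c ≠ p + 1 := fun h => c4 (by rw [← hinv c, h, hp1])
  have d4 : f c ≠ q := fun h => c3 (by rw [← hinv c, h, hq])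
  have key : linkedPair {p, q + 1} {c, f c} ↔ linkedPair {p + 1, q} {c, f c} := by
    rw [aux_linked n2 c1 c2 d1 d2, aux_linked n0 c3 c4 d3 d4]
    unfold linked
    rw [aux_shift hm n1 n2 n0 c1 c3 c4 c2, aux_shift hm n1 n2 n0 d1 d3 d4 d2]
  have hne : ({p, q + 1} : Finset (ZMod (2 * n))) ≠ {p + 1, q} := by
    intro h
    rcases aux_pair h with ⟨h, _⟩ | ⟨h, _⟩
    · exact n3 h
    · exact n1 h
  have m1 : ({p, q + 1} : Finset (ZMod (2 * n))) ∈ chords f := ⟨p, by rw [hp]⟩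
  have m2 : ({p + 1, q} : Finset (ZMod (2 * n))) ∈ chords f := ⟨p + 1, by rw [hp1]⟩
  generalize ({p, q + 1} : Finset (ZMod (2 * n))) = A at *
  generalize ({p + 1, q} : Finset (ZMod (2 * n))) = B at *
  generalize ({c, f c} : Finset (ZMod (2 * n))) = D at *
  by_cases hA : linkedPair A D
  · have hB := key.mp hA
    have hS : {E ∈ chords f | linkedPair E D} =
        insert A (insert B {E ∈ chords f | E ≠ A ∧ E ≠ B ∧ linkedPair E D}) := by
      ext E
      simp only [Set.mem_setOf_eq, Set.mem_insert_iff]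
      constructor
      · tauto
      · rintro (rfl | rfl | h)
        · exact ⟨m1, hA⟩
        · exact ⟨m2, hB⟩
        · exact ⟨h.1, h.2.2.2⟩
    rw [hS, Set.ncard_insert_of_notMem (by simp [hne]) (Set.toFinite _),
      Set.ncard_insert_of_notMem (by simp) (Set.toFinite _)]
    omega
  · have hB : ¬ linkedPair B D := fun h => hA (key.mpr h)
    have hS : {E ∈ chords f | linkedPair E D} =
        {E ∈ chords f | E ≠ A ∧ E ≠ B ∧ linkedPair E D} := by
      ext E
      simp only [Set.mem_setOf_eq]
      constructor
      · rintro ⟨h, h'⟩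
        exact ⟨h, fun e => hA (e ▸ h'), fun e => hB (e ▸ h'), h'⟩
      · tauto
    rw [hS]
end

section
/- Let m ≥ 5 and let u, u+1, w be three distinct points of ZMod m, and let d, d' be two distinct points of ZMod m with d, d' ∉ {u, u+1, w}. Then the pair {d, d'} is linked with {u, w} if and only if {d, d'} is linked with {u+1, w}. (Sliding an endpoint of a chord across an adjacent position that is not an endpoint of the other chord does not change the linking; this is the key step showing that under a third Reidemeister move each crossing A has the same Gaussian parity as the corresponding crossing A'.) -/
theorem arc_step {m : ℕ} [NeZero m] (a b u : ZMod m) (ha : u ≠ a) (hb : u + 1 ≠ b) :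
    inOpenArc a b u ↔ inOpenArc a b (u + 1) := by
  constructor
  · rintro ⟨k, hk, hlt, rfl⟩
    refine ⟨k + 1, by omega, ?_, by push_cast; ring⟩
    by_contra hcon
    have h : k + 1 = (b - a).val := by omega
    apply hb
    have h' : ((k + 1 : ℕ) : ZMod m) = b - a := by rw [h, ZMod.natCast_zmod_val]
    push_cast at h'
    rw [add_assoc, h']
    ring
  · rintro ⟨k, hk, hlt, he⟩
    obtain ⟨j, rfl⟩ : ∃ j, k = j + 1 := ⟨k - 1, by omega⟩
    push_cast at he
    have hu : u = a + (j : ZMod m) := by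
      rw [← add_assoc] at he
      exact add_right_cancel he
    refine ⟨j, ?_, by omega, hu⟩
    rcases Nat.eq_zero_or_pos j with rfl | h
    · simp at hu
      exact absurd hu ha
    · exact h

theorem pair_cases {α : Type*} [DecidableEq α] {a b c d : α}
    (h : ({a, b} : Finset α) = {c, d}) : (c = a ∧ d = b) ∨ (c = b ∧ d = a) := by
  have h1 : a ∈ ({c, d} : Finset α) := h ▸ (by simp)
  have h2 : b ∈ ({c, d} : Finset α) := h ▸ (by simp)
  have h3 : c ∈ ({a, b} : Finset α) := h ▸ (by simp)
  have h4 : d ∈ ({a, b} : Finset α) := h ▸ (by simp)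
  simp only [Finset.mem_insert, Finset.mem_singleton] at h1 h2 h3 h4
  grind

/-- Sliding an endpoint of a chord across an adjacent position which is not an
endpoint of the other chord does not change linking. -/
theorem slide_endpoint_preserves_linking (m : ℕ) (hm : 5 ≤ m)
    (u w d d' : ZMod m)
    (h1 : u ≠ u + 1) (h2 : u ≠ w) (h3 : u + 1 ≠ w) (hdd : d ≠ d')
    (hd : d ∉ ({u, u + 1, w} : Finset (ZMod m)))
    (hd' : d' ∉ ({u, u + 1, w} : Finset (ZMod m))) :
    linkedPair ({d, d'} : Finset (ZMod m)) ({u, w} : Finset (ZMod m)) ↔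
      linkedPair ({d, d'} : Finset (ZMod m)) ({u + 1, w} : Finset (ZMod m)) := by
  haveI : NeZero m := ⟨by omega⟩
  simp only [Finset.mem_insert, Finset.mem_singleton, not_or] at hd hd'
  obtain ⟨p1, p2, p3⟩ := hd
  obtain ⟨q1, q2, q3⟩ := hd'
  have key : ∀ a b : ZMod m, ({d, d'} : Finset (ZMod m)) = {a, b} →
      (inOpenArc a b u ↔ inOpenArc a b (u + 1)) := by
    intro a b hab
    rcases pair_cases hab with ⟨rfl, rfl⟩ | ⟨rfl, rfl⟩
    · exact arc_step _ _ _ (Ne.symm p1) (Ne.symm q2)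
    · exact arc_step _ _ _ (Ne.symm q1) (Ne.symm p2)
  constructor
  · rintro ⟨a, b, c, e, hP, hQ, hl⟩
    have hk := key a b hP
    rcases pair_cases hQ with ⟨rfl, rfl⟩ | ⟨rfl, rfl⟩
    · exact ⟨a, b, _, _, hP, rfl, by unfold linked at *; rwa [← hk]⟩
    · exact ⟨a, b, _, _, hP, rfl, by unfold linked at *; rw [← hk]; exact Or.symm hl⟩
  · rintro ⟨a, b, c, e, hP, hQ, hl⟩
    have hk := key a b hP
    rcases pair_cases hQ with ⟨rfl, rfl⟩ | ⟨rfl, rfl⟩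
    · exact ⟨a, b, _, _, hP, rfl, by unfold linked at *; rwa [hk]⟩
    · exact ⟨a, b, _, _, hP, rfl, by unfold linked at *; rw [hk]; exact Or.symm hl⟩
end
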